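/- Let G be a finite simple graph and s, t two distinct non-adjacent vertices of G. If there do not exist two internally vertex-disjoint paths from s to t in G, then either there is no path from s to t, or there exists a vertex v ∉ {s,t} such that every path from s to t passes through v (i.e., v is a cut vertex separating s from t). -/

import Mathlib

theorem exists_ear_aux {V : Type*} (G : SimpleGraph V) (S T : Set V) :
    ∀ (n : ℕ) (s t : V) (Q : G.Walk s t), Q.length ≤ n → s ∈ S → t ∈ T →
    ∃ (x y : V) (Q' : G.Walk x y), x ∈ S ∧ y ∈ T ∧ (∀ v ∈ Q'.support, v ∈ Q.support) ∧
      (∀ v ∈ Q'.support, v ∈ S → v = x) ∧ (∀ v ∈ Q'.support, v ∈ T → v = y) := by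
  classical
  intro n
  induction n with
  | zero =>
    intro s t Q hQ hs ht
    cases Q with
    | nil => exact ⟨s, s, .nil, hs, ht, by simp, by simp, by simp⟩
    | cons h p => simp at hQ
  | succ n ih =>
    intro s t Q hQ hs ht
    by_cases h1 : ∀ v ∈ Q.support, v ∈ S → v = s
    · by_cases h2 : ∀ v ∈ Q.support, v ∈ T → v = t
      · exact ⟨s, t, Q, hs, ht, fun _ h => h, h1, h2⟩
      · push Not at h2
        obtain ⟨v, hv, hvT, hne⟩ := h2
        have := Q.length_takeUntil_lt hv hne
        obtain ⟨x, y, Q', hx, hy, h3, h4, h5⟩ := ih s v (Q.takeUntil v hv) (by omega) hs hvT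
        exact ⟨x, y, Q', hx, hy, fun u hu => Q.support_takeUntil_subset hv (h3 u hu), h4, h5⟩
    · push Not at h1
      obtain ⟨v, hv, hvS, hne⟩ := h1
      have hl : (Q.dropUntil v hv).length < Q.length := by
        have e := congrArg SimpleGraph.Walk.length (Q.take_spec hv)
        rw [SimpleGraph.Walk.length_append] at e
        have : (Q.takeUntil v hv).length ≠ 0 := fun h0 =>
          hne (SimpleGraph.Walk.eq_of_length_eq_zero h0).symm
        omega
      obtain ⟨x, y, Q', hx, hy, h3, h4, h5⟩ := ih v t (Q.dropUntil v hv) (by omega) hvS ht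
      exact ⟨x, y, Q', hx, hy, fun u hu => Q.support_dropUntil_subset hv (h3 u hu), h4, h5⟩

theorem path_take_drop_aux {V : Type*} [DecidableEq V] {G : SimpleGraph V} {a b y v : V}
    (R : G.Walk a b) (hR : R.IsPath) (hy : y ∈ R.support)
    (h1 : v ∈ (R.takeUntil y hy).support) (h2 : v ∈ (R.dropUntil y hy).support) : v = y := by
  by_contra hne
  have hn := hR.support_nodup
  rw [← R.take_spec hy, SimpleGraph.Walk.support_append, List.nodup_append] at hn
  have h2' : v ∈ (R.dropUntil y hy).support.tail := by
    rw [SimpleGraph.Walk.mem_support_iff] at h2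
    exact h2.resolve_left hne
  exact hn.2.2 v h1 v h2' rfl

theorem whitney_aux {V : Type*} (G : SimpleGraph V) (s t : V)
    (hcut : ∀ v, v ≠ s → v ≠ t → ∃ p : G.Walk s t, v ∉ p.support) :
    ∀ (n : ℕ) (w : V) (A B : G.Walk s w) (R : G.Walk w t), R.length ≤ n → w ≠ s → R.IsPath →
    (∀ v, v ∈ A.support → v ∈ B.support → v = s ∨ v = w) →
    (∀ v, v ∈ A.support → v ∈ R.support → v = w) →
    (∀ v, v ∈ B.support → v ∈ R.support → v = w) →
    ∃ p q : G.Walk s t, p.IsPath ∧ q.IsPath ∧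
        ∀ v, v ∈ p.support → v ∈ q.support → v = s ∨ v = t := by
  classical
  intro n
  induction n with
  | zero =>
    intro w A B R hR hws hRp hAB hAR hBR
    obtain rfl := SimpleGraph.Walk.eq_of_length_eq_zero (Nat.le_zero.mp hR)
    exact ⟨A.bypass, B.bypass, A.bypass_isPath, B.bypass_isPath, fun v h1 h2 =>
      hAB v (A.support_bypass_subset h1) (B.support_bypass_subset h2)⟩
  | succ n ih =>
    intro w A B R hR hws hRp hAB hAR hBR
    by_cases hwt : w = t
    · subst hwt
      exact ⟨A.bypass, B.bypass, A.bypass_isPath, B.bypass_isPath, fun v h1 h2 =>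
        hAB v (A.support_bypass_subset h1) (B.support_bypass_subset h2)⟩
    -- replace `A` and `B` by paths
    obtain ⟨A, hAp, hA⟩ : ∃ A' : G.Walk s w, A'.IsPath ∧ ∀ v ∈ A'.support, v ∈ A.support :=
      ⟨A.bypass, A.bypass_isPath, fun v hv => A.support_bypass_subset hv⟩
    obtain ⟨B, hBp, hB⟩ : ∃ B' : G.Walk s w, B'.IsPath ∧ ∀ v ∈ B'.support, v ∈ B.support :=
      ⟨B.bypass, B.bypass_isPath, fun v hv => B.support_bypass_subset hv⟩
    replace hAB := fun v h1 h2 => hAB v (hA v h1) (hB v h2)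
    replace hAR := fun v h1 h2 => hAR v (hA v h1) h2
    replace hBR := fun v h1 h2 => hBR v (hB v h1) h2
    clear hA hB
    obtain ⟨Q, hQ⟩ := hcut w hws hwt
    obtain ⟨x, y, Q', hx, hy, hQQ, hS, hT⟩ := exists_ear_aux G
      {v | v ∈ A.support ∨ v ∈ B.support} {v | v ∈ R.support} Q.length s t Q le_rfl
      (Or.inl A.start_mem_support) R.end_mem_support
    have hwQ : w ∉ Q'.support := fun h => hQ (hQQ w h)
    have hxw : x ≠ w := fun h => hwQ (h ▸ Q'.start_mem_support)
    have hyw : y ≠ w := fun h => hwQ (h ▸ Q'.end_mem_support)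
    have hys : y ≠ s := by
      rintro rfl
      exact hyw (hAR _ A.start_mem_support hy)
    simp only [Set.mem_setOf_eq] at hx hy hS hT
    have key : ∀ A B : G.Walk s w, A.IsPath → x ∈ A.support →
        (∀ v, v ∈ A.support → v ∈ B.support → v = s ∨ v = w) →
        (∀ v, v ∈ A.support → v ∈ R.support → v = w) →
        (∀ v, v ∈ B.support → v ∈ R.support → v = w) →
        (∀ v ∈ Q'.support, v ∈ A.support ∨ v ∈ B.support → v = x) →
        ∃ p q : G.Walk s t, p.IsPath ∧ q.IsPath ∧
          ∀ v, v ∈ p.support → v ∈ q.support → v = s ∨ v = t := by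
      clear hAB hAR hBR hS hx hAp hBp
      intro A B hAp hx hAB hAR hBR hS
      -- initial segment of `A`, avoiding `w`
      obtain ⟨C, hCA, hwC⟩ : ∃ C : G.Walk s x, (∀ v ∈ C.support, v ∈ A.support) ∧
          w ∉ C.support := by
        exact ⟨A.takeUntil x hx, fun v hv => A.support_takeUntil_subset hx hv,
          SimpleGraph.Walk.endpoint_notMem_support_takeUntil hAp hx hxw.symm⟩
      have hl : (R.dropUntil y hy).length < R.length := by
        have e := congrArg SimpleGraph.Walk.length (R.take_spec hy)
        rw [SimpleGraph.Walk.length_append] at e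
        have : (R.takeUntil y hy).length ≠ 0 := fun h0 =>
          hyw (SimpleGraph.Walk.eq_of_length_eq_zero h0).symm
        omega
      have hwD : w ∉ (R.dropUntil y hy).support := fun h =>
        hyw (path_take_drop_aux R hRp hy (SimpleGraph.Walk.start_mem_support _) h).symm
      refine ih y (C.append Q') (B.append (R.takeUntil y hy)) (R.dropUntil y hy) (by omega) hys
        (hRp.dropUntil hy) ?_ ?_ ?_
      · intro v h1 h2
        rw [SimpleGraph.Walk.mem_support_append_iff] at h1 h2
        have h2 := h2.imp_right (fun h => R.support_takeUntil_subset hy h)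
        grind
      · intro v h1 h2
        rw [SimpleGraph.Walk.mem_support_append_iff] at h1
        have h2 := R.support_dropUntil_subset hy h2
        grind
      · intro v h1 h2
        rw [SimpleGraph.Walk.mem_support_append_iff] at h1
        rcases h1 with h1 | h1
        · have := hBR v h1 (R.support_dropUntil_subset hy h2)
          subst this
          exact absurd h2 hwD
        · exact path_take_drop_aux R hRp hy h1 h2
    rcases hx with hx | hx
    · exact key A B hAp hx hAB hAR hBR hS
    · exact key B A hBp hx (fun v h1 h2 => hAB v h2 h1) hBR hAR (fun v h1 h2 => hS v h1 h2.symm)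

theorem no_two_disjoint_paths_cut_vertex {V : Type*} [Fintype V]
    (G : SimpleGraph V) (s t : V) (hst : s ≠ t) (hadj : ¬G.Adj s t)
    (h : ¬∃ p q : G.Walk s t, p.IsPath ∧ q.IsPath ∧
        ∀ v, v ∈ p.support → v ∈ q.support → v = s ∨ v = t) :
    (¬G.Reachable s t) ∨
      ∃ v, v ≠ s ∧ v ≠ t ∧ ∀ p : G.Walk s t, v ∈ p.support := by
  classical
  by_contra hc
  push Not at hc
  obtain ⟨⟨P⟩, hcut⟩ := hc
  have hP := P.bypass_isPath
  apply h
  generalize P.bypass = P at hP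
  cases P with
  | nil => exact absurd rfl hst
  | @cons _ w _ hsw R =>
    rw [SimpleGraph.Walk.cons_isPath_iff] at hP
    refine whitney_aux G s t hcut R.length w hsw.toWalk hsw.toWalk R le_rfl hsw.ne' hP.1 ?_ ?_ ?_
    · intro v h1 _
      simpa using h1
    · intro v h1 h2
      have : v = s ∨ v = w := by simpa using h1
      grind
    · intro v h1 h2
      have : v = s ∨ v = w := by simpa using h1
      grind
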